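/- arXiv:1301.0659 — 4 statements merged into one kernel-verified Lean document; each statement's English description precedes it below -/
import Mathlib

section
/- Assume n ≥ 4. For every k with 1 ≤ k ≤ n−1, every alternating tensor t ∈ (ℝ^n)^{⊗k} that is so(p,q)-invariant is zero. -/
namespace Stmt4
noncomputable section
open Matrix

/-- The diagonal matrix `J` with `p` entries `1` followed by `q` entries `-1`. -/
def Jmat (p q : ℕ) : Matrix (Fin (p+q)) (Fin (p+q)) ℝ :=
  Matrix.diagonal fun i => if (i : ℕ) < p then (1 : ℝ) else -1

/-- Membership in the indefinite orthogonal Lie algebra `so(p,q)`: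
`Xᵀ J + J X = 0`. -/
def soCond (p q : ℕ) (X : Matrix (Fin (p+q)) (Fin (p+q)) ℝ) : Prop :=
  Xᵀ * Jmat p q + Jmat p q * X = 0

/-- The `k`-th tensor power of `ℝ^n`, in coordinates with respect to the
standard basis: a tensor is the function assigning to each multi-index
`f : Fin k → Fin n` the coefficient of `e_{f 0} ⊗ ⋯ ⊗ e_{f (k-1)}`. -/
abbrev Tens (n k : ℕ) := (Fin k → Fin n) → ℝ

/-- The basis tensor `e_{g 0} ⊗ ⋯ ⊗ e_{g (k-1)}`. -/
def basisT {n k : ℕ} (g : Fin k → Fin n) : Tens n k :=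
  fun f => if f = g then 1 else 0

/-- The derivation action of an `n × n` matrix `X` on the `k`-th tensor power
of the standard representation `ℝ^n`:
`X·(a₁ ⊗ ⋯ ⊗ a_k) = Σ_s a₁ ⊗ ⋯ ⊗ (X·a_s) ⊗ ⋯ ⊗ a_k`, in coordinates. -/
def actT {n k : ℕ} (X : Matrix (Fin n) (Fin n) ℝ) (t : Tens n k) : Tens n k :=
  fun f => ∑ s : Fin k, ∑ m : Fin n, X (f s) m * t (Function.update f s m)

/-- A tensor is alternating if permuting its factors by any permutation `σ`
multiplies it by `sgn σ`. -/
def IsAlt {n k : ℕ} (t : Tens n k) : Prop :=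
  ∀ σ : Equiv.Perm (Fin k), ∀ f : Fin k → Fin n,
    t (f ∘ σ) = ((Equiv.Perm.sign σ : ℤ) : ℝ) * t f




theorem IsAlt.eq_zero_of_apply_eq {n k : ℕ} {t : Tens n k} (ht : IsAlt t) {f : Fin k → Fin n}
    {i j : Fin k} (hf : f i = f j) (hij : i ≠ j) : t f = 0 := by
  have h := ht (Equiv.swap i j) f
  have hfs : f ∘ Equiv.swap i j = f := by
    funext x
    simp only [Function.comp_apply, Equiv.swap_apply_def]
    split_ifs with h₁ h₂
    · rw [h₁, hf]
    · rw [h₂, hf]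
    · rfl
  rw [hfs, Equiv.Perm.sign_swap hij] at h
  push_cast at h
  linarith

/-- The infinitesimal rotation in the plane spanned by `e_a` and `e_b`, with respect to the
diagonal form with entries `d`. -/
def planeRot {n : ℕ} (d : Fin n → ℝ) (a b : Fin n) : Matrix (Fin n) (Fin n) ℝ :=
  fun i j => (if i = b ∧ j = a then d a else 0) - (if i = a ∧ j = b then d b else 0)

theorem planeRot_skew {n : ℕ} (d : Fin n → ℝ) (a b : Fin n) :
    (planeRot d a b)ᵀ * diagonal d + diagonal d * planeRot d a b = 0 := by
  ext i j
  simp only [Matrix.add_apply, Matrix.mul_diagonal, Matrix.diagonal_mul, Matrix.transpose_apply,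
    Matrix.zero_apply, planeRot]
  grind

theorem actT_planeRot_update {n k : ℕ} (d : Fin n → ℝ) (t : Tens n k) {f : Fin k → Fin n}
    (hf : Function.Injective f) (s : Fin k) {b : Fin n} (hb : ∀ r, f r ≠ b) :
    actT (planeRot d (f s) b) t (Function.update f s b) = d (f s) * t f := by
  unfold actT
  rw [Finset.sum_eq_single s, Finset.sum_eq_single (f s)]
  · simp [planeRot, (hb s).symm]
  · intro m _ hm
    simp [planeRot, hm, (hb s).symm]
  · simp
  · intro r _ hr
    refine Finset.sum_eq_zero fun m _ => ?_
    simp [planeRot, hr, hb r, hf.eq_iff]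
  · simp

/-- For `n = p + q ≥ 4` and `1 ≤ k ≤ n - 1`, every alternating
`so(p,q)`-invariant tensor in `(ℝ^n)^{⊗k}` is zero. -/
theorem stmt_4 (p q : ℕ) (hp : 1 ≤ p) (hq : 1 ≤ q) (hn : 4 ≤ p + q)
    (k : ℕ) (hk1 : 1 ≤ k) (hk2 : k ≤ p + q - 1)
    (t : Tens (p+q) k) (halt : IsAlt t)
    (hinv : ∀ X : Matrix (Fin (p+q)) (Fin (p+q)) ℝ, soCond p q X → actT X t = 0) :
    t = 0 := by
  funext f
  by_cases hf : Function.Injective f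
  · obtain ⟨b, hb⟩ : ∃ b, ∀ r, f r ≠ b := by
      by_contra! h
      have hcard := Fintype.card_le_of_surjective f h
      simp only [Fintype.card_fin] at hcard
      omega
    have h := congrFun (hinv _ (planeRot_skew _ (f ⟨0, hk1⟩) b)) (Function.update f ⟨0, hk1⟩ b)
    rw [actT_planeRot_update _ t hf _ hb] at h
    refine (mul_eq_zero.mp h).resolve_left ?_
    split_ifs <;> norm_num
  · obtain ⟨i, j, hfij, hij⟩ := Function.not_injective_iff.mp hf
    exact halt.eq_zero_of_apply_eq hfij hij

end
end Stmt4
end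

section
/- Assume n ≥ 4. The space of alternating so(p,q)-invariant tensors in (ℝ^n)^{⊗n} is exactly the one-dimensional span of α̃ = Σ_{σ∈S_n} sgn(σ) e_{σ(1)} ⊗ e_{σ(2)} ⊗ … ⊗ e_{σ(n)}. -/
namespace Stmt5
noncomputable section
open Matrix

/-- The diagonal matrix `J` with `p` entries `1` followed by `q` entries `-1`. -/
def Jmat (p q : ℕ) : Matrix (Fin (p+q)) (Fin (p+q)) ℝ :=
  Matrix.diagonal fun i => if (i : ℕ) < p then (1 : ℝ) else -1

/-- Membership in the indefinite orthogonal Lie algebra `so(p,q)`: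
`Xᵀ J + J X = 0`. -/
def soCond (p q : ℕ) (X : Matrix (Fin (p+q)) (Fin (p+q)) ℝ) : Prop :=
  Xᵀ * Jmat p q + Jmat p q * X = 0

/-- The `k`-th tensor power of `ℝ^n`, in coordinates with respect to the
standard basis: a tensor is the function assigning to each multi-index
`f : Fin k → Fin n` the coefficient of `e_{f 0} ⊗ ⋯ ⊗ e_{f (k-1)}`. -/
abbrev Tens (n k : ℕ) := (Fin k → Fin n) → ℝ

/-- The basis tensor `e_{g 0} ⊗ ⋯ ⊗ e_{g (k-1)}`. -/
def basisT {n k : ℕ} (g : Fin k → Fin n) : Tens n k :=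
  fun f => if f = g then 1 else 0

/-- The derivation action of an `n × n` matrix `X` on the `k`-th tensor power
of the standard representation `ℝ^n`:
`X·(a₁ ⊗ ⋯ ⊗ a_k) = Σ_s a₁ ⊗ ⋯ ⊗ (X·a_s) ⊗ ⋯ ⊗ a_k`, in coordinates. -/
def actT {n k : ℕ} (X : Matrix (Fin n) (Fin n) ℝ) (t : Tens n k) : Tens n k :=
  fun f => ∑ s : Fin k, ∑ m : Fin n, X (f s) m * t (Function.update f s m)

/-- A tensor is alternating if permuting its factors by any permutation `σ`
multiplies it by `sgn σ`. -/
def IsAlt {n k : ℕ} (t : Tens n k) : Prop :=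
  ∀ σ : Equiv.Perm (Fin k), ∀ f : Fin k → Fin n,
    t (f ∘ σ) = ((Equiv.Perm.sign σ : ℤ) : ℝ) * t f


/-- The antisymmetrized volume element
`α̃ = Σ_{σ ∈ S_n} sgn(σ) e_{σ(1)} ⊗ ⋯ ⊗ e_{σ(n)}`. -/
def altVol (n : ℕ) : Tens n n :=
  fun f => ∑ σ : Equiv.Perm (Fin n), ((Equiv.Perm.sign σ : ℤ) : ℝ) * basisT (⇑σ) f


theorem IsAlt.apply_eq_zero {n k : ℕ} {t : Tens n k} (ht : IsAlt t) {f : Fin k → Fin n}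
    {a b : Fin k} (hab : a ≠ b) (hf : f a = f b) : t f = 0 := by
  have h := ht (Equiv.swap a b) f
  have hfs : f ∘ Equiv.swap a b = f := by
    ext x
    simp only [Function.comp_apply, Equiv.swap_apply_def]
    split_ifs with h1 h2 <;> simp [*]
  rw [hfs, Equiv.Perm.sign_swap hab] at h
  push_cast at h
  linarith

theorem altVol_coe_perm {n : ℕ} (σ : Equiv.Perm (Fin n)) :
    altVol n σ = ((Equiv.Perm.sign σ : ℤ) : ℝ) := by
  simp [altVol, basisT, DFunLike.coe_fn_eq]

theorem isAlt_altVol (n : ℕ) : IsAlt (altVol n) := by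
  intro τ f
  simp only [altVol, Finset.mul_sum]
  rw [← Equiv.sum_comp (Equiv.mulRight τ)]
  refine Finset.sum_congr rfl fun σ _ => ?_
  have h : f ∘ τ = ⇑(σ * τ) ↔ f = σ := by
    rw [Equiv.Perm.coe_mul]
    exact τ.surjective.injective_comp_right.eq_iff
  simp only [Equiv.coe_mulRight, basisT, h, Equiv.Perm.sign_mul]
  push_cast
  ring

theorem IsAlt.smul {n k : ℕ} {t : Tens n k} (ht : IsAlt t) (c : ℝ) : IsAlt (c • t) := by
  intro σ f
  simp only [Pi.smul_apply, smul_eq_mul, ht σ f]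
  ring

theorem IsAlt.eq_smul_altVol {n : ℕ} {t : Tens n n} (ht : IsAlt t) :
    t = t id • altVol n := by
  ext f
  by_cases hf : Function.Injective f
  · obtain ⟨σ, rfl⟩ : ∃ σ : Equiv.Perm (Fin n), ⇑σ = f :=
      ⟨Equiv.ofBijective f (Finite.injective_iff_bijective.mp hf), rfl⟩
    rw [Pi.smul_apply, altVol_coe_perm, smul_eq_mul, mul_comm]
    exact ht σ id
  · obtain ⟨a, b, hfab, hab⟩ := Function.not_injective_iff.mp hf
    rw [Pi.smul_apply, ht.apply_eq_zero hab hfab,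
      (isAlt_altVol n).apply_eq_zero hab hfab, smul_zero]

theorem soCond.diag_eq_zero {p q : ℕ} {X : Matrix (Fin (p+q)) (Fin (p+q)) ℝ}
    (hX : soCond p q X) (i : Fin (p+q)) : X i i = 0 := by
  have h := congrFun (congrFun hX i) i
  simp only [Jmat, Matrix.add_apply, Matrix.mul_diagonal, Matrix.diagonal_mul,
    Matrix.transpose_apply, Matrix.zero_apply] at h
  split_ifs at h <;> linarith

/-- A matrix with zero diagonal annihilates every alternating tensor of top degree. -/
theorem IsAlt.actT_eq_zero {n : ℕ} {t : Tens n n} (ht : IsAlt t)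
    {X : Matrix (Fin n) (Fin n) ℝ} (hX : ∀ i, X i i = 0) : actT X t = 0 := by
  ext f
  simp only [actT, Pi.zero_apply]
  by_cases hf : Function.Injective f
  · refine Finset.sum_eq_zero fun s _ => Finset.sum_eq_zero fun m _ => ?_
    obtain ⟨r, rfl⟩ := (Finite.injective_iff_surjective.mp hf) m
    by_cases hrs : r = s
    · rw [hrs, hX, zero_mul]
    · rw [ht.apply_eq_zero hrs (by simp [hrs]), mul_zero]
  · obtain ⟨a, b, hfab, hab⟩ := Function.not_injective_iff.mp hf
    rw [Finset.sum_eq_add a b hab, ← Finset.sum_add_distrib]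
    · refine Finset.sum_eq_zero fun m _ => ?_
      have hswap : Function.update f b m = Function.update f a m ∘ Equiv.swap a b := by
        ext x
        simp only [Function.comp_apply, Equiv.swap_apply_def, Function.update_apply]
        split_ifs <;> simp_all
      rw [hswap, ht, Equiv.Perm.sign_swap hab, hfab]
      push_cast
      ring
    · intro s _ hs
      refine Finset.sum_eq_zero fun m _ => ?_
      rw [ht.apply_eq_zero hab (by simp [hs.1.symm, hs.2.symm, hfab]), mul_zero]
    · simp
    · simp

/-- For `n = p + q ≥ 4`, the alternating `so(p,q)`-invariant tensors in
`(ℝ^n)^{⊗n}` form exactly the one-dimensional span of `α̃`. -/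
theorem stmt_5 (p q : ℕ) (hp : 1 ≤ p) (hq : 1 ≤ q) (hn : 4 ≤ p + q) :
    altVol (p+q) ≠ 0 ∧
    {t : Tens (p+q) (p+q) | IsAlt t ∧
        ∀ X : Matrix (Fin (p+q)) (Fin (p+q)) ℝ, soCond p q X → actT X t = 0}
      = {t : Tens (p+q) (p+q) | ∃ c : ℝ, t = c • altVol (p+q)} := by
  refine ⟨fun h => ?_, Set.ext fun t => ⟨fun ht => ⟨t id, ht.1.eq_smul_altVol⟩, ?_⟩⟩
  · have h1 := congrFun h ⇑(1 : Equiv.Perm (Fin (p+q)))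
    rw [altVol_coe_perm] at h1
    simp at h1
  · rintro ⟨c, rfl⟩
    have hc := (isAlt_altVol (p+q)).smul c
    exact ⟨hc, fun X hX => hc.actT_eq_zero hX.diag_eq_zero⟩

end
end Stmt5
end

section
/- Assume n ≥ 4. The space of so(p,q)-invariant elements of ℝ^n ⊗ ℝ^n is exactly the one-dimensional span of δ_{p,q} = Σ_{i=1}^{p} e_i ⊗ e_i − Σ_{i=p+1}^{n} e_i ⊗ e_i. -/
namespace Stmt7
noncomputable section
open Matrix

/-- The diagonal matrix `J` with `p` entries `1` followed by `q` entries `-1`. -/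
def Jmat (p q : ℕ) : Matrix (Fin (p+q)) (Fin (p+q)) ℝ :=
  Matrix.diagonal fun i => if (i : ℕ) < p then (1 : ℝ) else -1

/-- Membership in the indefinite orthogonal Lie algebra `so(p,q)`:
`Xᵀ J + J X = 0`. -/
def soCond (p q : ℕ) (X : Matrix (Fin (p+q)) (Fin (p+q)) ℝ) : Prop :=
  Xᵀ * Jmat p q + Jmat p q * X = 0

/-- The `k`-th tensor power of `ℝ^n`, in coordinates with respect to the
standard basis: a tensor is the function assigning to each multi-index
`f : Fin k → Fin n` the coefficient of `e_{f 0} ⊗ ⋯ ⊗ e_{f (k-1)}`. -/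
abbrev Tens (n k : ℕ) := (Fin k → Fin n) → ℝ

/-- The basis tensor `e_{g 0} ⊗ ⋯ ⊗ e_{g (k-1)}`. -/
def basisT {n k : ℕ} (g : Fin k → Fin n) : Tens n k :=
  fun f => if f = g then 1 else 0

/-- The derivation action of an `n × n` matrix `X` on the `k`-th tensor power
of the standard representation `ℝ^n`:
`X·(a₁ ⊗ ⋯ ⊗ a_k) = Σ_s a₁ ⊗ ⋯ ⊗ (X·a_s) ⊗ ⋯ ⊗ a_k`, in coordinates. -/
def actT {n k : ℕ} (X : Matrix (Fin n) (Fin n) ℝ) (t : Tens n k) : Tens n k :=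
  fun f => ∑ s : Fin k, ∑ m : Fin n, X (f s) m * t (Function.update f s m)

/-- A tensor is alternating if permuting its factors by any permutation `σ`
multiplies it by `sgn σ`. -/
def IsAlt {n k : ℕ} (t : Tens n k) : Prop :=
  ∀ σ : Equiv.Perm (Fin k), ∀ f : Fin k → Fin n,
    t (f ∘ σ) = ((Equiv.Perm.sign σ : ℤ) : ℝ) * t f


/-- `δ_{p,q} = Σ_{i ≤ p} e_i ⊗ e_i − Σ_{i > p} e_i ⊗ e_i ∈ ℝ^n ⊗ ℝ^n`. -/
def deltaT (p q : ℕ) : Tens (p+q) 2 :=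
  fun f => ∑ i : Fin (p+q),
    (if (i : ℕ) < p then (1 : ℝ) else -1) * basisT (fun _ => i) f

/-- The `i`-th diagonal entry of `Jmat p q`. -/
def jSign (p : ℕ) {n : ℕ} (i : Fin n) : ℝ := if (i : ℕ) < p then 1 else -1

lemma jSign_mul_self (p : ℕ) {n : ℕ} (i : Fin n) : jSign p i * jSign p i = 1 := by
  unfold jSign; split_ifs <;> norm_num

lemma jSign_ne_zero (p : ℕ) {n : ℕ} (i : Fin n) : jSign p i ≠ 0 := by
  unfold jSign; split_ifs <;> norm_num

lemma soCond_iff {p q : ℕ} {X : Matrix (Fin (p+q)) (Fin (p+q)) ℝ} :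
    soCond p q X ↔ ∀ i j, X j i * jSign p j + jSign p i * X i j = 0 := by
  unfold soCond Jmat
  rw [← Matrix.ext_iff]
  simp only [Matrix.add_apply, Matrix.mul_diagonal, Matrix.diagonal_mul, Matrix.transpose_apply,
    Matrix.zero_apply, jSign]

lemma actT_two_apply {n : ℕ} (X : Matrix (Fin n) (Fin n) ℝ) (t : Tens n 2) (i j : Fin n) :
    actT X t ![i, j] = ∑ m, X i m * t ![m, j] + ∑ m, X j m * t ![i, m] := by
  have h0 (m : Fin n) : Function.update ![i, j] 0 m = ![m, j] := by
    ext k; fin_cases k <;> rfl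
  have h1 (m : Fin n) : Function.update ![i, j] 1 m = ![i, m] := by
    ext k; fin_cases k <;> rfl
  simp [actT, Fin.sum_univ_two, h0, h1]

lemma deltaT_apply (p q : ℕ) (i j : Fin (p+q)) :
    deltaT p q ![i, j] = if i = j then jSign p i else 0 := by
  have h (k : Fin (p+q)) : (![i, j] = fun _ => k) ↔ i = k ∧ j = k := by
    simp [funext_iff, Fin.forall_fin_two]
  simp only [deltaT, basisT, h, mul_ite, mul_one, mul_zero, ite_and]
  rw [Finset.sum_ite_eq]
  simp [jSign, eq_comm]

lemma tens_two_ext {n : ℕ} {s t : Tens n 2} (h : ∀ i j, s ![i, j] = t ![i, j]) : s = t := by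
  ext f
  have hf : f = ![f 0, f 1] := by ext k; fin_cases k <;> rfl
  rw [hf, h]

lemma actT_deltaT {p q : ℕ} {X : Matrix (Fin (p+q)) (Fin (p+q)) ℝ} (hX : soCond p q X) :
    actT X (deltaT p q) = 0 := by
  refine tens_two_ext fun i j => ?_
  rw [actT_two_apply]
  simp only [deltaT_apply, mul_ite, mul_zero, Finset.sum_ite_eq, Finset.sum_ite_eq',
    Finset.mem_univ, if_true, Pi.zero_apply]
  linear_combination jSign p i * jSign p j * soCond_iff.1 hX i j
    - X j i * jSign p i * jSign_mul_self p j - X i j * jSign p j * jSign_mul_self p i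

/-- The infinitesimal rotation (or boost) in the plane spanned by `e_a` and `e_b`. -/
def planeGen (p : ℕ) {n : ℕ} (a b : Fin n) : Matrix (Fin n) (Fin n) ℝ :=
  Matrix.single a b (jSign p b) - Matrix.single b a (jSign p a)

lemma soCond_planeGen (p q : ℕ) (a b : Fin (p+q)) : soCond p q (planeGen p a b) := by
  rw [soCond_iff]
  intro i j
  simp only [planeGen, Matrix.sub_apply, Matrix.single_apply]
  by_cases h1 : a = i <;> by_cases h2 : b = j <;> by_cases h3 : a = j <;> by_cases h4 : b = i <;>
    simp_all

lemma actT_planeGen_apply (p : ℕ) {n : ℕ} (a b : Fin n) (t : Tens n 2) (i j : Fin n) :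
    actT (planeGen p a b) t ![i, j] =
      (if a = i then jSign p b * t ![b, j] else 0) - (if b = i then jSign p a * t ![a, j] else 0)
      + ((if a = j then jSign p b * t ![i, b] else 0)
        - (if b = j then jSign p a * t ![i, a] else 0)) := by
  rw [actT_two_apply]
  simp [planeGen, Matrix.sub_apply, Matrix.single_apply, sub_mul, Finset.sum_sub_distrib,
    ite_and, ite_mul]

/-- For `n = p + q ≥ 4`, the `so(p,q)`-invariant elements of `ℝ^n ⊗ ℝ^n` form
exactly the one-dimensional span of `δ_{p,q}`. -/
theorem stmt_7 (p q : ℕ) (hp : 1 ≤ p) (hq : 1 ≤ q) (hn : 4 ≤ p + q) :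
    deltaT p q ≠ 0 ∧
    {t : Tens (p+q) 2 |
        ∀ X : Matrix (Fin (p+q)) (Fin (p+q)) ℝ, soCond p q X → actT X t = 0}
      = {t : Tens (p+q) 2 | ∃ c : ℝ, t = c • deltaT p q} := by
  obtain ⟨o⟩ : Nonempty (Fin (p+q)) := ⟨⟨0, by omega⟩⟩
  refine ⟨fun h => ?_, Set.ext fun t => ⟨fun ht => ?_, ?_⟩⟩
  · have := congrFun h ![o, o]
    rw [deltaT_apply, if_pos rfl] at this
    exact jSign_ne_zero p o this
  · have inv (a b i j : Fin (p+q)) : actT (planeGen p a b) t ![i, j] = 0 :=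
      congrFun (ht _ (soCond_planeGen p q a b)) _
    simp only [actT_planeGen_apply] at inv
    have off (b c : Fin (p+q)) (hbc : b ≠ c) : t ![b, c] = 0 := by
      obtain ⟨a, hab, hac⟩ := Fin.exists_ne_and_ne_of_two_lt b c (by omega)
      simpa [hab, hab.symm, hac, hbc, jSign_ne_zero] using inv a b a c
    have diag (a b : Fin (p+q)) : jSign p a * t ![a, a] = jSign p b * t ![b, b] := by
      rcases eq_or_ne a b with rfl | hab
      · rfl
      · have := inv a b a b
        simp only [hab, hab.symm, if_true, if_false] at this
        linarith
    refine ⟨jSign p o * t ![o, o], tens_two_ext fun i j => ?_⟩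
    rw [Pi.smul_apply, deltaT_apply, smul_eq_mul]
    split_ifs with hij
    · subst hij
      linear_combination jSign p i * diag i o - t ![i, i] * jSign_mul_self p i
    · rw [off i j hij, mul_zero]
  · rintro ⟨c, rfl⟩ X hX
    have smul : actT X (c • deltaT p q) = c • actT X (deltaT p q) := by
      ext f
      simp only [actT, Pi.smul_apply, smul_eq_mul, Finset.mul_sum, mul_left_comm]
    rw [smul, actT_deltaT hX, smul_zero]

end
end Stmt7
end

section
/- Assume n ≥ 4. For every k with 0 ≤ k ≤ n and k ∉ {1, n−1}, every so(p,q)-invariant tensor in (ℝ^n)^{⊗(k+1)} that is alternating in the last k factors is zero. -/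
namespace Stmt10
noncomputable section
open Matrix

/-- The diagonal matrix `J` with `p` entries `1` followed by `q` entries `-1`. -/
def Jmat (p q : ℕ) : Matrix (Fin (p+q)) (Fin (p+q)) ℝ :=
  Matrix.diagonal fun i => if (i : ℕ) < p then (1 : ℝ) else -1

/-- Membership in the indefinite orthogonal Lie algebra `so(p,q)`:
`Xᵀ J + J X = 0`. -/
def soCond (p q : ℕ) (X : Matrix (Fin (p+q)) (Fin (p+q)) ℝ) : Prop :=
  Xᵀ * Jmat p q + Jmat p q * X = 0

/-- The `k`-th tensor power of `ℝ^n`, in coordinates with respect to the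
standard basis: a tensor is the function assigning to each multi-index
`f : Fin k → Fin n` the coefficient of `e_{f 0} ⊗ ⋯ ⊗ e_{f (k-1)}`. -/
abbrev Tens (n k : ℕ) := (Fin k → Fin n) → ℝ

/-- The basis tensor `e_{g 0} ⊗ ⋯ ⊗ e_{g (k-1)}`. -/
def basisT {n k : ℕ} (g : Fin k → Fin n) : Tens n k :=
  fun f => if f = g then 1 else 0

/-- The derivation action of an `n × n` matrix `X` on the `k`-th tensor power
of the standard representation `ℝ^n`:
`X·(a₁ ⊗ ⋯ ⊗ a_k) = Σ_s a₁ ⊗ ⋯ ⊗ (X·a_s) ⊗ ⋯ ⊗ a_k`, in coordinates. -/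
def actT {n k : ℕ} (X : Matrix (Fin n) (Fin n) ℝ) (t : Tens n k) : Tens n k :=
  fun f => ∑ s : Fin k, ∑ m : Fin n, X (f s) m * t (Function.update f s m)

/-- A tensor is alternating if permuting its factors by any permutation `σ`
multiplies it by `sgn σ`. -/
def IsAlt {n k : ℕ} (t : Tens n k) : Prop :=
  ∀ σ : Equiv.Perm (Fin k), ∀ f : Fin k → Fin n,
    t (f ∘ σ) = ((Equiv.Perm.sign σ : ℤ) : ℝ) * t f


/-- A degree-`(k+1)` tensor is alternating in its last `k` factors if permuting
those factors by any permutation `σ` (leaving the first factor fixed)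
multiplies it by `sgn σ`. -/
def AltLast {n k : ℕ} (t : Tens n (k+1)) : Prop :=
  ∀ σ : Equiv.Perm (Fin k), ∀ f : Fin (k+1) → Fin n,
    t (Fin.cons (f 0) (fun a => f ((σ a).succ))) = ((Equiv.Perm.sign σ : ℤ) : ℝ) * t f


/-- The sign `±1` of the `i`-th diagonal entry of `Jmat p q`. -/
def signJ (p q : ℕ) (i : Fin (p+q)) : ℝ := if (i : ℕ) < p then 1 else -1

lemma signJ_mul_self (p q : ℕ) (i : Fin (p+q)) : signJ p q i * signJ p q i = 1 := by
  unfold signJ; split_ifs <;> norm_num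

lemma signJ_ne_zero (p q : ℕ) (i : Fin (p+q)) : signJ p q i ≠ 0 := by
  unfold signJ; split_ifs <;> norm_num

/-- The infinitesimal (pseudo-)rotation in the `(a, b)`-plane. -/
def rot (p q : ℕ) (a b : Fin (p+q)) : Matrix (Fin (p+q)) (Fin (p+q)) ℝ :=
  Matrix.single a b (signJ p q a) - Matrix.single b a (signJ p q b)

lemma soCond_rot (p q : ℕ) (a b : Fin (p+q)) : soCond p q (rot p q a b) := by
  have hJ : Jmat p q = Matrix.diagonal (signJ p q) := rfl
  ext i j
  simp only [rot, hJ, Matrix.add_apply, Matrix.mul_diagonal, Matrix.diagonal_mul,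
    Matrix.transpose_apply, Matrix.sub_apply, Matrix.single_apply, Matrix.zero_apply]
  have ha := signJ_mul_self p q a
  have hb := signJ_mul_self p q b
  grind

lemma actT_rot {p q k : ℕ} (a b : Fin (p+q)) (t : Tens (p+q) k) (f : Fin k → Fin (p+q)) :
    actT (rot p q a b) t f = ∑ s : Fin k,
      ((if f s = a then signJ p q a * t (Function.update f s b) else 0) -
        if f s = b then signJ p q b * t (Function.update f s a) else 0) := by
  refine Finset.sum_congr rfl fun s _ => ?_
  simp [rot, Matrix.single_apply, sub_mul, Finset.sum_sub_distrib, ite_and, eq_comm]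

lemma AltLast.eq_zero_of_eq {n k : ℕ} {t : Tens n (k+1)} (halt : AltLast t) (i : Fin n)
    {g : Fin k → Fin n} {r s : Fin k} (hrs : r ≠ s) (h : g r = g s) :
    t (Fin.cons i g) = 0 := by
  have key := halt (Equiv.swap r s) (Fin.cons i g)
  have hg : (fun x => g (Equiv.swap r s x)) = g := by
    funext x
    rcases eq_or_ne x r with rfl | hr
    · simp [h]
    rcases eq_or_ne x s with rfl | hs
    · simp [h]
    rw [Equiv.swap_apply_of_ne_of_ne hr hs]
  simp only [Fin.cons_zero, Fin.cons_succ, hg, Equiv.Perm.sign_swap hrs] at key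
  push_cast at key
  linarith

/-- An invariant tensor vanishes at an index whose head `i` does not occur in its tail, provided
that some other value `a` does not occur at all. -/
lemma apply_cons_eq_zero_of_notMem {p q k : ℕ} {t : Tens (p+q) (k+1)}
    (hinv : ∀ X : Matrix (Fin (p+q)) (Fin (p+q)) ℝ, soCond p q X → actT X t = 0)
    {a i : Fin (p+q)} {g : Fin k → Fin (p+q)} (hai : a ≠ i) (ha : ∀ s, g s ≠ a)
    (hi : ∀ s, g s ≠ i) : t (Fin.cons i g) = 0 := by
  have key := congrFun (hinv _ (soCond_rot p q a i)) (Fin.cons a g)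
  rw [actT_rot, Fin.sum_univ_succ] at key
  simpa [ha, hi, hai, signJ_ne_zero] using key

/-- An invariant tensor alternating in its tail vanishes at an index whose head `a` also occurs
in its tail together with a different value `b`. -/
lemma apply_cons_eq_zero_of_mem {p q k : ℕ} {t : Tens (p+q) (k+1)} (halt : AltLast t)
    (hinv : ∀ X : Matrix (Fin (p+q)) (Fin (p+q)) ℝ, soCond p q X → actT X t = 0)
    {a b : Fin (p+q)} {g : Fin k → Fin (p+q)} {r s : Fin k} (hab : a ≠ b) (hr : g r = a)
    (hs : g s = b) : t (Fin.cons a g) = 0 := by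
  have key := congrFun (hinv _ (soCond_rot p q a b)) (Fin.cons b g)
  rw [actT_rot, Fin.sum_univ_succ, Finset.sum_eq_zero] at key
  · simpa [hab.symm, signJ_ne_zero] using key
  intro j _
  simp only [Fin.cons_succ, ← Fin.cons_update]
  have h₁ : g j = a → t (Fin.cons b (Function.update g j b)) = 0 := fun hj => by
    have hjs : j ≠ s := by rintro rfl; exact hab (hj.symm.trans hs)
    exact halt.eq_zero_of_eq b hjs (by simp [hjs.symm, hs])
  have h₂ : g j = b → t (Fin.cons b (Function.update g j a)) = 0 := fun hj => by
    have hjr : j ≠ r := by rintro rfl; exact hab (hr.symm.trans hj)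
    exact halt.eq_zero_of_eq b hjr (by simp [hjr.symm, hr])
  split_ifs <;> simp_all

/-- For `n = p + q ≥ 4` and `0 ≤ k ≤ n` with `k ∉ {1, n−1}`, every
`so(p,q)`-invariant tensor in `(ℝ^n)^{⊗(k+1)}` that is alternating in the last
`k` factors is zero. -/
theorem stmt_10 (p q : ℕ) (hp : 1 ≤ p) (hq : 1 ≤ q) (hn : 4 ≤ p + q)
    (k : ℕ) (hk : k ≤ p + q) (hk1 : k ≠ 1) (hk2 : k ≠ p + q - 1)
    (t : Tens (p+q) (k+1)) (halt : AltLast t)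
    (hinv : ∀ X : Matrix (Fin (p+q)) (Fin (p+q)) ℝ, soCond p q X → actT X t = 0) :
    t = 0 := by
  funext f
  rw [← Fin.cons_self_tail f]
  generalize f 0 = i, Fin.tail f = g
  by_cases hg : Function.Injective g
  swap
  · obtain ⟨r, s, h, hrs⟩ := Function.not_injective_iff.mp hg
    exact halt.eq_zero_of_eq i hrs h
  by_cases hi : ∃ r, g r = i
  · obtain ⟨r, hr⟩ := hi
    have : Nontrivial (Fin k) := Fin.nontrivial_iff_two_le.mpr (by have := r.2; omega)
    obtain ⟨s, hs⟩ := exists_ne r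
    exact apply_cons_eq_zero_of_mem halt hinv (fun h => hs (hg (h.symm.trans hr.symm))) hr rfl
  · push Not at hi
    have hinj : Function.Injective (Fin.cons i g : Fin (k+1) → Fin (p+q)) :=
      Fin.cons_injective_iff.mpr ⟨by simpa using hi, hg⟩
    have hcard := Fintype.card_le_of_injective _ hinj
    have hsurj : ¬ Function.Surjective (Fin.cons i g : Fin (k+1) → Fin (p+q)) := fun h => by
      have := Fintype.card_le_of_surjective _ h
      simp only [Fintype.card_fin] at this hcard
      omega
    simp only [Function.Surjective, not_forall, not_exists] at hsurj
    obtain ⟨a, ha⟩ := hsurj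
    exact apply_cons_eq_zero_of_notMem hinv (fun h : a = i => ha 0 (by simp [h]))
      (fun s => by simpa using ha s.succ) hi

end
end Stmt10
end
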